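/- Monotonicity of the compound-state χ-quantity under marginals (eq. (3.60), second inequality): χ{P_f, ε_{if}} ≥ χ{P_f, ε_i} and χ{P_f, ε_{if}} ≥ χ{P_f, ε_f}, where for each ω with P_f(ω) > 0 one sets ε_{if}(ω) := Σ_{α : p(α,ω) > 0} P_{i|f}(α|ω)·(ρ_α ⊗ η_f^α), ε_i(ω) := Σ_{α : p(α,ω) > 0} P_{i|f}(α|ω)·ρ_α and ε_f(ω) := Σ_{α : p(α,ω) > 0} P_{i|f}(α|ω)·η_f^α (the marginals of ε_{if}(ω)); in particular, combined with I_c ≥ χ{P_f, ε_{if}}, this yields Scutaru's bound I_c ≥ χ{P_f, ε_i}. -/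

import Mathlib

open Matrix BigOperators
open scoped Kronecker ComplexOrder

noncomputable section

/-- A density matrix: positive semidefinite with unit trace. -/
def IsDensityMatrix {ι : Type*} [Fintype ι] (ρ : Matrix ι ι ℂ) : Prop :=
  ρ.PosSemidef ∧ ρ.trace = 1

/-- von Neumann entropy (natural logarithm), via the eigenvalues;
junk value `0` if the matrix is not Hermitian. -/
noncomputable def vnEntropy {ι : Type*} [Fintype ι] [DecidableEq ι]
    (ρ : Matrix ι ι ℂ) : ℝ :=
  if h : ρ.IsHermitian then -∑ i, h.eigenvalues i * Real.log (h.eigenvalues i) else 0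

/-- Quantum relative entropy `S(σ|τ)` (natural logarithm), computed in an orthonormal
eigenbasis of `τ`; junk value `0` if `σ` or `τ` is not Hermitian. -/
noncomputable def relEnt {ι : Type*} [Fintype ι] [DecidableEq ι]
    (σ τ : Matrix ι ι ℂ) : ℝ :=
  if h : σ.IsHermitian ∧ τ.IsHermitian then
    (∑ i, h.1.eigenvalues i * Real.log (h.1.eigenvalues i))
      - ∑ j, (if 0 < h.2.eigenvalues j then
          Real.log (h.2.eigenvalues j) *
            ((star (fun i => h.2.eigenvectorBasis j i)) ⬝ᵥ
              σ.mulVec (fun i => h.2.eigenvectorBasis j i)).re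
        else 0)
  else 0

/-- Holevo χ-quantity of an ensemble of states, relative to its barycenter. -/
noncomputable def holevoChi {ι B : Type*} [Fintype ι] [DecidableEq ι] [Fintype B]
    (q : B → ℝ) (τ : B → Matrix ι ι ℂ) : ℝ :=
  ∑ β, if 0 < q β then q β * relEnt (τ β) (∑ γ, q γ • τ γ) else 0

/-- The action of an instrument in Kraus form: `I_ω(ρ) = ∑ k, V ω k * ρ * (V ω k)ᴴ`. -/
noncomputable def instAct {n m : ℕ} {Ω K : Type*} [Fintype K]
    (V : Ω → K → Matrix (Fin m) (Fin n) ℂ) (ω : Ω)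
    (ρ : Matrix (Fin n) (Fin n) ℂ) : Matrix (Fin m) (Fin m) ℂ :=
  ∑ k, V ω k * ρ * (V ω k)ᴴ

/-- The POVM associated with an instrument in Kraus form: `E_ω = ∑ k, (V ω k)ᴴ * V ω k`. -/
noncomputable def povm {n m : ℕ} {Ω K : Type*} [Fintype K]
    (V : Ω → K → Matrix (Fin m) (Fin n) ℂ) (ω : Ω) : Matrix (Fin n) (Fin n) ℂ :=
  ∑ k, (V ω k)ᴴ * V ω k

/-- Outcome probability `Tr(E_ω ρ)`. -/
noncomputable def probOut {n m : ℕ} {Ω K : Type*} [Fintype K]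
    (V : Ω → K → Matrix (Fin m) (Fin n) ℂ) (ρ : Matrix (Fin n) (Fin n) ℂ) (ω : Ω) : ℝ :=
  ((povm V ω * ρ).trace).re

/-- The a posteriori state `π_ρ(ω) = I_ω(ρ)/Tr(I_ω(ρ))` (junk if the trace vanishes). -/
noncomputable def post {n m : ℕ} {Ω K : Type*} [Fintype K]
    (V : Ω → K → Matrix (Fin m) (Fin n) ℂ) (ω : Ω)
    (ρ : Matrix (Fin n) (Fin n) ℂ) : Matrix (Fin m) (Fin m) ℂ :=
  (((instAct V ω ρ).trace.re)⁻¹ : ℝ) • instAct V ω ρ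

/-- The classical (Shannon) input/output mutual information of the ensemble `(p, ρ)`
measured with the POVM of the instrument `V`. -/
noncomputable def Ic {n m : ℕ} {A Ω K : Type*} [Fintype A] [Fintype Ω] [Fintype K]
    (p : A → ℝ) (ρ : A → Matrix (Fin n) (Fin n) ℂ)
    (V : Ω → K → Matrix (Fin m) (Fin n) ℂ) : ℝ :=
  ∑ α, ∑ ω,
    if 0 < p α * probOut V (ρ α) ω then
      p α * probOut V (ρ α) ω *
        Real.log ((p α * probOut V (ρ α) ω) /
          (p α * probOut V (∑ β, p β • ρ β) ω))
    else 0

/-- Quantum information gain of the instrument `V` at the state `ρ`. -/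
noncomputable def infoGain {n m : ℕ} {Ω K : Type*} [Fintype Ω] [Fintype K]
    (V : Ω → K → Matrix (Fin m) (Fin n) ℂ) (ρ : Matrix (Fin n) (Fin n) ℂ) : ℝ :=
  vnEntropy ρ - ∑ ω, if 0 < (instAct V ω ρ).trace.re then
    (instAct V ω ρ).trace.re * vnEntropy (post V ω ρ) else 0


section ClassicalComparison

open Filter Topology

theorem hasDerivAt_weighted_log {w l m T : ℝ} (hl : 0 ≤ l) (hm : 0 ≤ m) (hT : 0 < T) :
    HasDerivAt (fun T => w * l * Real.log (m + T * l)) (w * (l ^ 2 / (m + T * l))) T := by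
  rcases hl.eq_or_lt with rfl | hl
  · simpa using hasDerivAt_const T (0 : ℝ)
  · have hpos : 0 < m + T * l := by positivity
    have h1 : HasDerivAt (fun T : ℝ => m + T * l) l T := by
      simpa using ((hasDerivAt_id T).mul_const l).const_add m
    exact ((h1.log hpos.ne').const_mul (w * l)).congr_deriv (by ring)

theorem continuousOn_weighted_log {w l m : ℝ} (hl : 0 ≤ l) (hm : 0 ≤ m)
    (hs : m = 0 → w * l = 0) :
    ContinuousOn (fun T => w * l * Real.log (m + T * l)) (Set.Ici 0) := by
  rcases hm.eq_or_lt with h | hm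
  · simp only [hs h.symm, zero_mul]
    exact continuousOn_const
  · refine continuousOn_const.mul (ContinuousOn.log (by fun_prop) fun T hT => ?_)
    have : 0 ≤ T * l := mul_nonneg hT hl
    positivity

theorem tendsto_weighted_log {w l m : ℝ} (hl : 0 ≤ l) (hm : 0 ≤ m) :
    Tendsto (fun T => w * l * Real.log (m + T * l) - w * l * Real.log T) atTop
      (𝓝 (w * l * Real.log l)) := by
  rcases hl.eq_or_lt with rfl | hl
  · simp
  · have h1 : Tendsto (fun T : ℝ => w * l * Real.log (m / T + l)) atTop
        (𝓝 (w * l * Real.log (0 + l))) := by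
      refine Tendsto.const_mul _ (Tendsto.log ?_ (by simpa using hl.ne'))
      exact (tendsto_const_nhds.div_atTop tendsto_id).add_const l
    rw [zero_add] at h1
    refine h1.congr' ?_
    filter_upwards [eventually_gt_atTop 0] with T hT
    have : m / T + l = (m + T * l) / T := by field_simp
    rw [this, Real.log_div (by positivity) hT.ne']
    ring

/-- Domination of all the resolvent sums `∑ w l² / (m + t l)` implies domination of the weighted
Kullback–Leibler sums. -/
theorem sum_mul_log_sub_log_le_of_resolvent_le {I J : Type*} [Fintype I] [Fintype J]
    (w l m : I → ℝ) (w' l' m' : J → ℝ)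
    (hl : ∀ i, 0 ≤ l i) (hm : ∀ i, 0 ≤ m i) (hs : ∀ i, m i = 0 → w i * l i = 0)
    (hl' : ∀ i, 0 ≤ l' i) (hm' : ∀ i, 0 ≤ m' i) (hs' : ∀ i, m' i = 0 → w' i * l' i = 0)
    (htr : ∑ i, w i * l i = ∑ i, w' i * l' i)
    (hR : ∀ t > 0, ∑ i, w i * (l i ^ 2 / (m i + t * l i)) ≤
      ∑ i, w' i * (l' i ^ 2 / (m' i + t * l' i))) :
    ∑ i, w i * l i * (Real.log (l i) - Real.log (m i)) ≤
      ∑ i, w' i * l' i * (Real.log (l' i) - Real.log (m' i)) := by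
  set H : ℝ → ℝ := fun T => ∑ i, w' i * l' i * Real.log (m' i + T * l' i) -
    ∑ i, w i * l i * Real.log (m i + T * l i) with hH
  have hcont : ContinuousOn H (Set.Ici 0) :=
    (continuousOn_finsetSum _ fun i _ => continuousOn_weighted_log (hl' i) (hm' i) (hs' i)).sub
      (continuousOn_finsetSum _ fun i _ => continuousOn_weighted_log (hl i) (hm i) (hs i))
  have hderiv : ∀ T > 0, HasDerivAt H (∑ i, w' i * (l' i ^ 2 / (m' i + T * l' i)) -
      ∑ i, w i * (l i ^ 2 / (m i + T * l i))) T := fun T hT =>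
    (HasDerivAt.fun_sum fun i _ => hasDerivAt_weighted_log (hl' i) (hm' i) hT).sub
      (HasDerivAt.fun_sum fun i _ => hasDerivAt_weighted_log (hl i) (hm i) hT)
  have hmono : MonotoneOn H (Set.Ici 0) := by
    refine monotoneOn_of_deriv_nonneg (convex_Ici 0) hcont ?_ ?_
    · intro T hT
      rw [interior_Ici] at hT
      exact (hderiv T hT).differentiableAt.differentiableWithinAt
    · intro T hT
      rw [interior_Ici] at hT
      rw [(hderiv T hT).deriv]
      exact sub_nonneg.2 (hR T hT)
  have hlim : Tendsto H atTop (𝓝 (∑ i, w' i * l' i * Real.log (l' i) -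
      ∑ i, w i * l i * Real.log (l i))) := by
    refine ((tendsto_finsetSum Finset.univ fun i _ =>
      tendsto_weighted_log (w := w' i) (hl' i) (hm' i)).sub
      (tendsto_finsetSum Finset.univ fun i _ =>
        tendsto_weighted_log (w := w i) (hl i) (hm i))).congr fun T => ?_
    simp only [Finset.sum_sub_distrib, ← Finset.sum_mul, hH, htr]
    ring
  have h0 : H 0 ≤ _ := ge_of_tendsto hlim <| by
    filter_upwards [eventually_ge_atTop 0] with T hT
    exact hmono (Set.self_mem_Ici) hT hT
  simp only [hH, zero_mul, add_zero] at h0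
  simp only [mul_sub, Finset.sum_sub_distrib]
  linarith

end ClassicalComparison


section RelativeEntropy

/-- The quadratic functional whose supremum over `X` is the resolvent quantity
`⟨σ, (L_τ + t R_σ)⁻¹ σ⟩` of the pair `(σ, τ)`. It is linear in `(σ, τ)`. -/
def resolventForm {ι : Type*} [Fintype ι] (t : ℝ) (σ τ X : Matrix ι ι ℂ) : ℝ :=
  2 * (Xᴴ * σ).trace.re - (X * Xᴴ * τ).trace.re - t * (Xᴴ * X * σ).trace.re

variable {ι κ : Type*} [Fintype ι] [DecidableEq ι] [Fintype κ] [DecidableEq κ]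

theorem resolventForm_conj_diagonal (t : ℝ) {U V : Matrix ι ι ℂ} (hU : Uᴴ * U = 1)
    (hV : Vᴴ * V = 1) (l m : ι → ℝ) (Y : Matrix ι ι ℂ) :
    resolventForm t (U * diagonal (fun i => (l i : ℂ)) * Uᴴ)
      (V * diagonal (fun i => (m i : ℂ)) * Vᴴ) (V * Y * Uᴴ) =
    ∑ x : ι × ι, (2 * (star (Y x.1 x.2) * (Vᴴ * U) x.1 x.2).re * l x.2 -
      (m x.1 + t * l x.2) * Complex.normSq (Y x.1 x.2)) := by
  have hU' (Z : Matrix ι ι ℂ) : Uᴴ * (U * Z) = Z := by rw [← mul_assoc, hU, one_mul]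
  have hV' (Z : Matrix ι ι ℂ) : Vᴴ * (V * Z) = Z := by rw [← mul_assoc, hV, one_mul]
  set D := diagonal (fun i => (l i : ℂ))
  set M := diagonal (fun i => (m i : ℂ))
  have h1 : ((V * Y * Uᴴ)ᴴ * (U * D * Uᴴ)).trace = (Yᴴ * (Vᴴ * U * D)).trace := by
    rw [← mul_assoc, trace_mul_comm]
    simp only [conjTranspose_mul, conjTranspose_conjTranspose, mul_assoc, hU']
  have h2 : ((V * Y * Uᴴ) * (V * Y * Uᴴ)ᴴ * (V * M * Vᴴ)).trace = (Y * (Yᴴ * M)).trace := by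
    rw [← mul_assoc, trace_mul_comm]
    simp only [conjTranspose_mul, conjTranspose_conjTranspose, mul_assoc, hU', hV']
  have h3 : ((V * Y * Uᴴ)ᴴ * (V * Y * Uᴴ) * (U * D * Uᴴ)).trace = (Yᴴ * (Y * D)).trace := by
    rw [← mul_assoc, trace_mul_comm]
    simp only [conjTranspose_mul, conjTranspose_conjTranspose, mul_assoc, hU', hV']
  have h4 (W : Matrix ι ι ℂ) : (Yᴴ * (W * D)).trace.re =
      ∑ x : ι × ι, (star (Y x.1 x.2) * W x.1 x.2).re * l x.2 := by
    rw [← mul_assoc, Fintype.sum_prod_type, Finset.sum_comm]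
    simp only [trace, diag_apply, D, mul_diagonal, Complex.re_sum, Complex.re_mul_ofReal]
    simp only [mul_apply, conjTranspose_apply, Complex.re_sum, Finset.sum_mul]
  have h5 : (Y * (Yᴴ * M)).trace.re = ∑ x : ι × ι, m x.1 * Complex.normSq (Y x.1 x.2) := by
    rw [← mul_assoc, Fintype.sum_prod_type]
    simp only [trace, diag_apply, M, mul_diagonal, Complex.re_sum, Complex.re_mul_ofReal]
    simp only [mul_apply, conjTranspose_apply, Complex.re_sum, Finset.sum_mul]
    refine Finset.sum_congr rfl fun j _ => Finset.sum_congr rfl fun i _ => ?_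
    rw [Complex.star_def, Complex.mul_conj, Complex.ofReal_re, mul_comm]
  have h6 (z : ℂ) : (star z * z).re = Complex.normSq z := by
    rw [mul_comm, Complex.star_def, Complex.mul_conj, Complex.ofReal_re]
  rw [resolventForm, h1, h2, h3, h4, h4, h5]
  simp only [h6, Finset.mul_sum, ← Finset.sum_sub_distrib]
  refine Finset.sum_congr rfl fun x _ => by ring

/-- The squared overlaps of the eigenvectors of two Hermitian matrices. -/
def eigenOverlap {σ τ : Matrix ι ι ℂ} (hσ : σ.IsHermitian) (hτ : τ.IsHermitian) (x : ι × ι) : ℝ :=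
  Complex.normSq (((hτ.eigenvectorUnitary : Matrix ι ι ℂ)ᴴ *
    (hσ.eigenvectorUnitary : Matrix ι ι ℂ)) x.1 x.2)

theorem eigenOverlap_nonneg {σ τ : Matrix ι ι ℂ} (hσ : σ.IsHermitian) (hτ : τ.IsHermitian)
    (x : ι × ι) : 0 ≤ eigenOverlap hσ hτ x :=
  Complex.normSq_nonneg _

theorem eigenvectorUnitary_conjTranspose_mul_self {σ : Matrix ι ι ℂ} (hσ : σ.IsHermitian) :
    (hσ.eigenvectorUnitary : Matrix ι ι ℂ)ᴴ * (hσ.eigenvectorUnitary : Matrix ι ι ℂ) = 1 :=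
  Unitary.coe_star_mul_self hσ.eigenvectorUnitary

theorem eigenvectorUnitary_mul_conjTranspose_self {σ : Matrix ι ι ℂ} (hσ : σ.IsHermitian) :
    (hσ.eigenvectorUnitary : Matrix ι ι ℂ) * (hσ.eigenvectorUnitary : Matrix ι ι ℂ)ᴴ = 1 :=
  Unitary.coe_mul_star_self hσ.eigenvectorUnitary

theorem eq_eigenvectorUnitary_conj {σ : Matrix ι ι ℂ} (hσ : σ.IsHermitian) :
    σ = (hσ.eigenvectorUnitary : Matrix ι ι ℂ) * diagonal (fun i => (hσ.eigenvalues i : ℂ)) *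
      (hσ.eigenvectorUnitary : Matrix ι ι ℂ)ᴴ :=
  hσ.spectral_theorem

theorem sum_eigenOverlap_left {σ τ : Matrix ι ι ℂ} (hσ : σ.IsHermitian) (hτ : τ.IsHermitian)
    (i : ι) : ∑ j, eigenOverlap hσ hτ (j, i) = 1 := by
  set W := (hτ.eigenvectorUnitary : Matrix ι ι ℂ)ᴴ * (hσ.eigenvectorUnitary : Matrix ι ι ℂ)
    with hW
  have h : Wᴴ * W = 1 := by
    rw [hW, conjTranspose_mul, conjTranspose_conjTranspose, mul_assoc,
      ← mul_assoc _ _ (hσ.eigenvectorUnitary : Matrix ι ι ℂ),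
      eigenvectorUnitary_mul_conjTranspose_self, one_mul,
      eigenvectorUnitary_conjTranspose_mul_self]
  have h' := congrArg Complex.re (congrFun (congrFun h i) i)
  rw [mul_apply, Complex.re_sum, one_apply_eq, Complex.one_re] at h'
  rw [← h']
  refine Finset.sum_congr rfl fun j _ => ?_
  rw [conjTranspose_apply, mul_comm, Complex.star_def, Complex.mul_conj, Complex.ofReal_re]
  rfl

theorem re_eigenvector_dotProduct_mulVec {σ τ : Matrix ι ι ℂ} (hσ : σ.IsHermitian)
    (hτ : τ.IsHermitian) (j : ι) :
    ((star (fun i => hτ.eigenvectorBasis j i)) ⬝ᵥ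
      σ.mulVec (fun i => hτ.eigenvectorBasis j i)).re =
      ∑ i, eigenOverlap hσ hτ (j, i) * hσ.eigenvalues i := by
  set V := (hτ.eigenvectorUnitary : Matrix ι ι ℂ) with hV
  set U := (hσ.eigenvectorUnitary : Matrix ι ι ℂ) with hU
  set D := diagonal (fun i => (hσ.eigenvalues i : ℂ)) with hD
  have h1 : (star (fun i => hτ.eigenvectorBasis j i)) ⬝ᵥ
      σ.mulVec (fun i => hτ.eigenvectorBasis j i) = (Vᴴ * (σ * V)) j j := by
    simp only [dotProduct, mulVec, mul_apply, conjTranspose_apply,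
      Pi.star_apply, hV, Matrix.IsHermitian.eigenvectorUnitary_apply]
  have h2 : Vᴴ * (σ * V) = (Vᴴ * U) * D * (Vᴴ * U)ᴴ := by
    conv_lhs => rw [eq_eigenvectorUnitary_conj hσ]
    simp only [conjTranspose_mul, conjTranspose_conjTranspose, mul_assoc, hU, hD]
  rw [h1, h2, mul_apply, Complex.re_sum]
  refine Finset.sum_congr rfl fun i _ => ?_
  rw [hD, mul_diagonal, conjTranspose_apply, mul_right_comm, Complex.star_def, Complex.mul_conj,
    ← Complex.ofReal_mul, Complex.ofReal_re]
  rfl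

/-- The relative entropy as a classical weighted Kullback–Leibler sum. -/
theorem relEnt_eq_sum_eigenOverlap {σ τ : Matrix ι ι ℂ} (hσ : σ.PosSemidef) (hτ : τ.PosSemidef) :
    relEnt σ τ = ∑ x : ι × ι, eigenOverlap hσ.1 hτ.1 x * hσ.1.eigenvalues x.2 *
      (Real.log (hσ.1.eigenvalues x.2) - Real.log (hτ.1.eigenvalues x.1)) := by
  rw [relEnt, dif_pos ⟨hσ.1, hτ.1⟩]
  simp only [mul_sub, Finset.sum_sub_distrib]
  congr 1
  · rw [Fintype.sum_prod_type, Finset.sum_comm]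
    refine Finset.sum_congr rfl fun i _ => ?_
    simp only [mul_assoc, ← Finset.sum_mul, sum_eigenOverlap_left, one_mul]
  · rw [Fintype.sum_prod_type]
    refine Finset.sum_congr rfl fun j _ => ?_
    dsimp only
    rw [← Finset.sum_mul, ← re_eigenvector_dotProduct_mulVec hσ.1 hτ.1 j]
    split_ifs with h
    · rw [mul_comm]
    · rw [le_antisymm (not_lt.1 h) (hτ.eigenvalues_nonneg j), Real.log_zero, mul_zero]

theorem sum_eigenOverlap_mul_eigenvalues {σ τ : Matrix ι ι ℂ} (hσ : σ.IsHermitian)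
    (hτ : τ.IsHermitian) :
    ∑ x : ι × ι, eigenOverlap hσ hτ x * hσ.eigenvalues x.2 = σ.trace.re := by
  rw [hσ.trace_eq_sum_eigenvalues, Fintype.sum_prod_type, Finset.sum_comm, Complex.re_sum]
  refine Finset.sum_congr rfl fun i _ => ?_
  dsimp only
  rw [← Finset.sum_mul, sum_eigenOverlap_left, one_mul]
  rfl

theorem eigenOverlap_mul_eigenvalues_eq_zero {σ τ : Matrix ι ι ℂ} (hσ : σ.PosSemidef)
    (hτ : τ.PosSemidef) {c : ℝ} (hc : 0 < c) (hle : (τ - c • σ).PosSemidef) (x : ι × ι)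
    (hx : hτ.1.eigenvalues x.1 = 0) :
    eigenOverlap hσ.1 hτ.1 x * hσ.1.eigenvalues x.2 = 0 := by
  have hnn : ∀ i ∈ Finset.univ, 0 ≤ eigenOverlap hσ.1 hτ.1 (x.1, i) * hσ.1.eigenvalues i :=
    fun i _ => mul_nonneg (eigenOverlap_nonneg _ _ _) (hσ.eigenvalues_nonneg i)
  set v : ι → ℂ := fun i => hτ.1.eigenvectorBasis x.1 i with hv
  have h1 := hle.re_dotProduct_nonneg v
  have h2 : τ.mulVec v = 0 := by
    have := hτ.1.mulVec_eigenvectorBasis x.1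
    rw [hx, zero_smul] at this
    exact this
  rw [sub_mulVec, h2, zero_sub, dotProduct_neg, smul_mulVec, dotProduct_smul,
    RCLike.re_eq_complex_re, Complex.neg_re, Complex.smul_re, smul_eq_mul,
    re_eigenvector_dotProduct_mulVec hσ.1 hτ.1] at h1
  have h3 := Finset.sum_nonneg hnn
  have h4 : ∑ i, eigenOverlap hσ.1 hτ.1 (x.1, i) * hσ.1.eigenvalues i = 0 := by nlinarith
  exact (Finset.sum_eq_zero_iff_of_nonneg hnn).1 h4 x.2 (Finset.mem_univ _)

/-- The supremum of `resolventForm t σ τ` in spectral terms. -/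
def resolventSup {σ τ : Matrix ι ι ℂ} (hσ : σ.IsHermitian) (hτ : τ.IsHermitian) (t : ℝ) : ℝ :=
  ∑ x : ι × ι, eigenOverlap hσ hτ x *
    (hσ.eigenvalues x.2 ^ 2 / (hτ.eigenvalues x.1 + t * hσ.eigenvalues x.2))

theorem two_mul_re_sub_le (z y : ℂ) {l d : ℝ} (hd : 0 ≤ d) (h : d = 0 → l = 0) :
    2 * (star y * z).re * l - d * Complex.normSq y ≤ Complex.normSq z * (l ^ 2 / d) := by
  rcases hd.eq_or_lt with hd | hd
  · simp [h hd.symm, ← hd]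
  · have key : 0 ≤ Complex.normSq ((l : ℂ) * z - (d : ℂ) * y) := Complex.normSq_nonneg _
    rw [← mul_div_assoc, le_div_iff₀ hd]
    simp only [Complex.normSq_apply, Complex.star_def, Complex.mul_re, Complex.conj_re,
      Complex.conj_im, Complex.sub_re, Complex.sub_im, Complex.mul_im, Complex.ofReal_re,
      Complex.ofReal_im] at key ⊢
    linarith

theorem two_mul_re_sub_eq (z : ℂ) {l d : ℝ} (hl : d = 0 → l = 0) :
    2 * (star (((l / d : ℝ) : ℂ) * z) * z).re * l - d * Complex.normSq (((l / d : ℝ) : ℂ) * z) =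
      Complex.normSq z * (l ^ 2 / d) := by
  by_cases hd : d = 0
  · simp [hl hd, hd]
  · simp only [Complex.normSq_apply, Complex.star_def, Complex.mul_re, Complex.conj_re,
      Complex.conj_im, Complex.mul_im, Complex.ofReal_re, Complex.ofReal_im]
    field_simp
    ring

theorem eq_zero_of_add_mul_eq_zero {l m t : ℝ} (ht : 0 < t) (hl : 0 ≤ l) (hm : 0 ≤ m)
    (h : m + t * l = 0) : l = 0 := by
  have : 0 ≤ t * l := by positivity
  have h' : t * l = 0 := by linarith
  exact (mul_eq_zero.1 h').resolve_left ht.ne'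

theorem resolventForm_le_resolventSup {σ τ : Matrix ι ι ℂ} (hσ : σ.PosSemidef) (hτ : τ.PosSemidef)
    {t : ℝ} (ht : 0 < t) (X : Matrix ι ι ℂ) :
    resolventForm t σ τ X ≤ resolventSup hσ.1 hτ.1 t := by
  set V := (hτ.1.eigenvectorUnitary : Matrix ι ι ℂ) with hV
  set U := (hσ.1.eigenvectorUnitary : Matrix ι ι ℂ) with hU
  have hX : X = V * (Vᴴ * X * U) * Uᴴ := by
    rw [← mul_assoc, ← mul_assoc, hV, eigenvectorUnitary_mul_conjTranspose_self, one_mul,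
      mul_assoc, hU, eigenvectorUnitary_mul_conjTranspose_self, mul_one]
  have h := resolventForm_conj_diagonal t (eigenvectorUnitary_conjTranspose_mul_self hσ.1)
    (eigenvectorUnitary_conjTranspose_mul_self hτ.1) hσ.1.eigenvalues hτ.1.eigenvalues
    (Vᴴ * X * U)
  rw [← eq_eigenvectorUnitary_conj, ← eq_eigenvectorUnitary_conj, ← hX] at h
  rw [h]
  refine Finset.sum_le_sum fun x _ => two_mul_re_sub_le _ _ ?_ ?_
  · exact add_nonneg (hτ.eigenvalues_nonneg _) (mul_nonneg ht.le (hσ.eigenvalues_nonneg _))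
  · exact eq_zero_of_add_mul_eq_zero ht (hσ.eigenvalues_nonneg _) (hτ.eigenvalues_nonneg _)

theorem exists_resolventForm_eq_resolventSup {σ τ : Matrix ι ι ℂ} (hσ : σ.PosSemidef)
    (hτ : τ.PosSemidef) {t : ℝ} (ht : 0 < t) :
    ∃ X, resolventForm t σ τ X = resolventSup hσ.1 hτ.1 t := by
  have h := resolventForm_conj_diagonal t (eigenvectorUnitary_conjTranspose_mul_self hσ.1)
    (eigenvectorUnitary_conjTranspose_mul_self hτ.1) hσ.1.eigenvalues hτ.1.eigenvalues
    (Matrix.of fun j i => ((hσ.1.eigenvalues i / (hτ.1.eigenvalues j + t * hσ.1.eigenvalues i) : ℝ)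
      : ℂ) * ((hτ.1.eigenvectorUnitary : Matrix ι ι ℂ)ᴴ *
        (hσ.1.eigenvectorUnitary : Matrix ι ι ℂ)) j i)
  rw [← eq_eigenvectorUnitary_conj, ← eq_eigenvectorUnitary_conj] at h
  refine ⟨_, h.trans ?_⟩
  refine Finset.sum_congr rfl fun x _ => two_mul_re_sub_eq _ ?_
  exact eq_zero_of_add_mul_eq_zero ht (hσ.eigenvalues_nonneg _) (hτ.eigenvalues_nonneg _)

/-- Monotonicity of the relative entropy under the partial trace, where the partial trace is
presented by its dual, an embedding `φ` of the observables. -/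
theorem relEnt_le_of_trace_embedding {σ τ : Matrix ι ι ℂ} {σ' τ' : Matrix κ κ ℂ}
    (hσ : σ.PosSemidef) (hτ : τ.PosSemidef) (hσ' : σ'.PosSemidef) (hτ' : τ'.PosSemidef)
    {c : ℝ} (hc : 0 < c) (hle : (τ - c • σ).PosSemidef) (hle' : (τ' - c • σ').PosSemidef)
    (φ : Matrix ι ι ℂ →⋆ₐ[ℂ] Matrix κ κ ℂ) (hφσ : ∀ X, (φ X * σ').trace = (X * σ).trace)
    (hφτ : ∀ X, (φ X * τ').trace = (X * τ).trace) :
    relEnt σ τ ≤ relEnt σ' τ' := by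
  rw [relEnt_eq_sum_eigenOverlap hσ hτ, relEnt_eq_sum_eigenOverlap hσ' hτ']
  refine sum_mul_log_sub_log_le_of_resolvent_le _ (fun x : ι × ι => hσ.1.eigenvalues x.2)
    (fun x => hτ.1.eigenvalues x.1) _ (fun x : κ × κ => hσ'.1.eigenvalues x.2)
    (fun x => hτ'.1.eigenvalues x.1) (fun _ => hσ.eigenvalues_nonneg _)
    (fun _ => hτ.eigenvalues_nonneg _)
    (eigenOverlap_mul_eigenvalues_eq_zero hσ hτ hc hle)
    (fun _ => hσ'.eigenvalues_nonneg _) (fun _ => hτ'.eigenvalues_nonneg _)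
    (eigenOverlap_mul_eigenvalues_eq_zero hσ' hτ' hc hle') ?_ fun t ht => ?_
  · rw [sum_eigenOverlap_mul_eigenvalues, sum_eigenOverlap_mul_eigenvalues]
    simpa using congrArg Complex.re (hφσ 1).symm
  · obtain ⟨X, hX⟩ := exists_resolventForm_eq_resolventSup hσ hτ ht
    refine hX.symm.le.trans (le_trans (le_of_eq ?_)
      (resolventForm_le_resolventSup hσ' hτ' ht (φ X)))
    simp only [resolventForm, ← star_eq_conjTranspose, ← map_star, ← map_mul, hφσ, hφτ]

theorem re_trace_mul_eq_conjTranspose {ν : Type*} [Fintype ν] {σ : Matrix ν ν ℂ}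
    (hσ : σ.IsHermitian) (X : Matrix ν ν ℂ) :
    (X * σ).trace.re = (Xᴴ * σ).trace.re := by
  rw [← Complex.conj_re, ← Complex.star_def, ← trace_conjTranspose, conjTranspose_mul, hσ.eq,
    trace_mul_comm]

theorem two_mul_re_trace_sub_sq_le {σ : Matrix ι ι ℂ} (hσ : IsDensityMatrix σ) (X : Matrix ι ι ℂ)
    (a : ℝ) : 2 * a * (Xᴴ * σ).trace.re - a ^ 2 ≤ (Xᴴ * X * σ).trace.re := by
  have h := (Complex.le_def.1
    (hσ.1.mul_mul_conjTranspose_same (X - (a : ℂ) • (1 : Matrix ι ι ℂ))).trace_nonneg).1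
  have e : ((X - (a : ℂ) • (1 : Matrix ι ι ℂ)) * σ * (X - (a : ℂ) • (1 : Matrix ι ι ℂ))ᴴ).trace =
      (Xᴴ * X * σ).trace - a * (X * σ).trace - a * (Xᴴ * σ).trace + a * a := by
    rw [trace_mul_comm, ← mul_assoc]
    simp only [conjTranspose_sub, conjTranspose_smul, conjTranspose_one, Complex.star_def,
      Complex.conj_ofReal, sub_mul, mul_sub, smul_mul_assoc, mul_smul_comm, one_mul, mul_one,
      trace_sub, trace_smul, hσ.2, smul_eq_mul]
    ring
  rw [e] at h
  simp only [Complex.zero_re, Complex.add_re, Complex.sub_re, Complex.re_ofReal_mul,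
    Complex.ofReal_re, re_trace_mul_eq_conjTranspose hσ.1.1 X] at h
  linarith

/-- Monotonicity of the relative entropy under a classical-to-quantum preparation. -/
theorem relEnt_sum_smul_le {A : Type*} [Fintype A] {ρ : A → Matrix ι ι ℂ}
    (hρ : ∀ α, IsDensityMatrix (ρ α)) {r s : A → ℝ} (hr : ∀ α, 0 ≤ r α) (hs : ∀ α, 0 ≤ s α)
    {c : ℝ} (hc : 0 < c) (hle : ∀ α, c * r α ≤ s α) {σ τ : Matrix ι ι ℂ}
    (hσ : σ = ∑ α, r α • ρ α) (hτ : τ = ∑ α, s α • ρ α) :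
    relEnt σ τ ≤ ∑ α, r α * (Real.log (r α) - Real.log (s α)) := by
  have hσp : σ.PosSemidef := hσ ▸ posSemidef_sum _ fun α _ => (hρ α).1.smul (hr α)
  have hτp : τ.PosSemidef := hτ ▸ posSemidef_sum _ fun α _ => (hρ α).1.smul (hs α)
  have hsub : (τ - c • σ).PosSemidef := by
    rw [hσ, hτ, Finset.smul_sum, ← Finset.sum_sub_distrib]
    refine posSemidef_sum _ fun α _ => ?_
    rw [smul_smul, ← sub_smul]
    exact (hρ α).1.smul (sub_nonneg.2 (hle α))
  rw [relEnt_eq_sum_eigenOverlap hσp hτp]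
  refine le_of_le_of_eq (sum_mul_log_sub_log_le_of_resolvent_le _
    (fun x : ι × ι => hσp.1.eigenvalues x.2) (fun x => hτp.1.eigenvalues x.1) (fun _ => 1) r s
    (fun _ => hσp.eigenvalues_nonneg _) (fun _ => hτp.eigenvalues_nonneg _)
    (eigenOverlap_mul_eigenvalues_eq_zero hσp hτp hc hsub) hr hs ?_ ?_ fun t ht => ?_)
    (by simp only [one_mul])
  · intro α h
    have := hle α
    rw [one_mul]
    nlinarith [hr α]
  · rw [sum_eigenOverlap_mul_eigenvalues, hσ, trace_sum, Complex.re_sum]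
    refine Finset.sum_congr rfl fun α _ => ?_
    rw [trace_smul, (hρ α).2, Complex.smul_re, Complex.one_re, smul_eq_mul, mul_comm]
  · obtain ⟨X, hX⟩ := exists_resolventForm_eq_resolventSup hσp hτp ht
    refine hX.symm.le.trans ?_
    have hsum : resolventForm t σ τ X = ∑ α, (r α * (2 * (Xᴴ * ρ α).trace.re) -
        s α * (X * Xᴴ * ρ α).trace.re - t * (r α * (Xᴴ * X * ρ α).trace.re)) := by
      simp only [resolventForm, hσ, hτ, Finset.mul_sum, trace_sum, Complex.re_sum, mul_smul_comm,
        trace_smul, Complex.smul_re, smul_eq_mul, ← Finset.sum_sub_distrib]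
      refine Finset.sum_congr rfl fun α _ => by ring
    rw [hsum]
    refine Finset.sum_le_sum fun α _ => ?_
    rw [one_mul]
    have hd : 0 ≤ s α + t * r α := add_nonneg (hs α) (mul_nonneg ht.le (hr α))
    have h1 (a : ℝ) : 2 * a * (Xᴴ * ρ α).trace.re - a ^ 2 ≤ (X * Xᴴ * ρ α).trace.re := by
      simpa [re_trace_mul_eq_conjTranspose (hρ α).1.1 X]
        using two_mul_re_trace_sub_sq_le (hρ α) Xᴴ a
    have h2 (a : ℝ) := two_mul_re_trace_sub_sq_le (hρ α) X a
    rcases hd.eq_or_lt with hd | hd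
    · have h0 := eq_zero_of_add_mul_eq_zero ht (hr α) (hs α) hd.symm
      simp only [h0, mul_zero, add_zero] at hd ⊢
      simp [← hd]
    · have e1 := mul_le_mul_of_nonneg_left (h1 (r α / (s α + t * r α))) (hs α)
      have e2 := mul_le_mul_of_nonneg_left (h2 (r α / (s α + t * r α)))
        (mul_nonneg ht.le (hr α))
      have e3 : (s α + t * r α) * (2 * (r α / (s α + t * r α)) * (Xᴴ * ρ α).trace.re -
          (r α / (s α + t * r α)) ^ 2) = r α * (2 * (Xᴴ * ρ α).trace.re) -
          r α ^ 2 / (s α + t * r α) := by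
        field_simp
      linarith

theorem posSemidef_smul_of_pos {ν : Type*} {q : ℝ} (hq : 0 ≤ q) {σ : Matrix ν ν ℂ}
    (hσ : 0 < q → σ.PosSemidef) : (q • σ).PosSemidef := by
  rcases hq.eq_or_lt with rfl | h
  · rw [zero_smul]
    exact PosSemidef.zero
  · exact (hσ h).smul hq

theorem posSemidef_barycenter_sub {ν B : Type*} [Fintype B] {q : B → ℝ} (hq : ∀ β, 0 ≤ q β)
    {τ : B → Matrix ν ν ℂ} (hτ : ∀ β, 0 < q β → (τ β).PosSemidef) (β : B) :
    (∑ γ, q γ • τ γ - q β • τ β).PosSemidef := by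
  classical
  rw [← Finset.add_sum_erase _ _ (Finset.mem_univ β), add_sub_cancel_left]
  exact posSemidef_sum _ fun γ _ => posSemidef_smul_of_pos (hq γ) (hτ γ)

/-- The Holevo quantity decreases under the partial trace, presented by its dual `φ`. -/
theorem holevoChi_le_of_trace_embedding {B : Type*} [Fintype B] {q : B → ℝ} (hq : ∀ β, 0 ≤ q β)
    {τ : B → Matrix ι ι ℂ} {τ' : B → Matrix κ κ ℂ} (hτ : ∀ β, 0 < q β → (τ β).PosSemidef)
    (hτ' : ∀ β, 0 < q β → (τ' β).PosSemidef) (φ : Matrix ι ι ℂ →⋆ₐ[ℂ] Matrix κ κ ℂ)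
    (hφ : ∀ β, 0 < q β → ∀ X, (φ X * τ' β).trace = (X * τ β).trace) :
    holevoChi q τ ≤ holevoChi q τ' := by
  refine Finset.sum_le_sum fun β _ => ?_
  split_ifs with hβ
  · refine mul_le_mul_of_nonneg_left ?_ hβ.le
    refine relEnt_le_of_trace_embedding (hτ β hβ) (posSemidef_sum _ fun γ _ => ?_) (hτ' β hβ)
      (posSemidef_sum _ fun γ _ => ?_) hβ ?_ ?_ φ (hφ β hβ) fun X => ?_
    · exact posSemidef_smul_of_pos (hq γ) (hτ γ)
    · exact posSemidef_smul_of_pos (hq γ) (hτ' γ)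
    · exact posSemidef_barycenter_sub hq hτ β
    · exact posSemidef_barycenter_sub hq hτ' β
    · simp only [Finset.mul_sum, trace_sum, mul_smul_comm, trace_smul]
      refine Finset.sum_congr rfl fun γ _ => ?_
      rcases (hq γ).eq_or_lt with h | h
      · rw [← h, zero_smul, zero_smul]
      · rw [hφ γ h]
  · exact le_rfl

/-- The embedding `X ↦ X ⊗ 1` of observables, dual to the partial trace over the second factor. -/
def kroneckerOne : Matrix ι ι ℂ →⋆ₐ[ℂ] Matrix (ι × κ) (ι × κ) ℂ where
  toFun X := X ⊗ₖ 1
  map_one' := one_kronecker_one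
  map_mul' X Y := by rw [← mul_kronecker_mul, one_mul]
  map_zero' := zero_kronecker _
  map_add' X Y := add_kronecker _ _ _
  commutes' z := by
    rw [Algebra.algebraMap_eq_smul_one, Algebra.algebraMap_eq_smul_one, smul_kronecker,
      one_kronecker_one]
  map_star' X := by
    rw [star_eq_conjTranspose, star_eq_conjTranspose, conjTranspose_kronecker, conjTranspose_one]

/-- The embedding `X ↦ 1 ⊗ X` of observables, dual to the partial trace over the first factor. -/
def oneKronecker : Matrix κ κ ℂ →⋆ₐ[ℂ] Matrix (ι × κ) (ι × κ) ℂ where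
  toFun X := 1 ⊗ₖ X
  map_one' := one_kronecker_one
  map_mul' X Y := by rw [← mul_kronecker_mul, one_mul]
  map_zero' := kronecker_zero _
  map_add' X Y := kronecker_add _ _ _
  commutes' z := by
    rw [Algebra.algebraMap_eq_smul_one, Algebra.algebraMap_eq_smul_one, kronecker_smul,
      one_kronecker_one]
  map_star' X := by
    rw [star_eq_conjTranspose, star_eq_conjTranspose, conjTranspose_kronecker, conjTranspose_one]

theorem trace_kroneckerOne_mul (X σ : Matrix ι ι ℂ) (τ : Matrix κ κ ℂ) :
    (kroneckerOne X * (σ ⊗ₖ τ)).trace = (X * σ).trace * τ.trace := by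
  change ((X ⊗ₖ 1) * (σ ⊗ₖ τ)).trace = _
  rw [← mul_kronecker_mul, one_mul, trace_kronecker]

theorem trace_oneKronecker_mul (X τ : Matrix κ κ ℂ) (σ : Matrix ι ι ℂ) :
    (oneKronecker X * (σ ⊗ₖ τ)).trace = σ.trace * (X * τ).trace := by
  change ((1 ⊗ₖ X) * (σ ⊗ₖ τ)).trace = _
  rw [← mul_kronecker_mul, one_mul, trace_kronecker]

end RelativeEntropy

section Instrument

variable {n m : ℕ} {Ω K : Type*} [Fintype K] {V : Ω → K → Matrix (Fin m) (Fin n) ℂ}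

theorem posSemidef_instAct {σ : Matrix (Fin n) (Fin n) ℂ} (hσ : σ.PosSemidef) (ω : Ω) :
    (instAct V ω σ).PosSemidef :=
  posSemidef_sum _ fun _ _ => hσ.mul_mul_conjTranspose_same _

theorem trace_povm_mul (σ : Matrix (Fin n) (Fin n) ℂ) (ω : Ω) :
    (povm V ω * σ).trace = (instAct V ω σ).trace := by
  rw [povm, instAct, Finset.sum_mul, trace_sum, trace_sum]
  refine Finset.sum_congr rfl fun k _ => ?_
  rw [Matrix.mul_assoc, trace_mul_comm]

theorem probOut_nonneg {σ : Matrix (Fin n) (Fin n) ℂ} (hσ : σ.PosSemidef) (ω : Ω) :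
    0 ≤ probOut V σ ω := by
  rw [probOut, trace_povm_mul]
  exact (Complex.le_def.1 (posSemidef_instAct hσ ω).trace_nonneg).1

theorem probOut_sum_smul {A : Type*} [Fintype A] (p : A → ℝ) (ρ : A → Matrix (Fin n) (Fin n) ℂ)
    (ω : Ω) : probOut V (∑ α, p α • ρ α) ω = ∑ α, p α * probOut V (ρ α) ω := by
  simp only [probOut, Finset.mul_sum, trace_sum, Complex.re_sum, mul_smul_comm, trace_smul,
    Complex.smul_re, smul_eq_mul]

variable [Fintype Ω]

theorem sum_trace_povm_mul (hV : ∑ ω, ∑ k, (V ω k)ᴴ * V ω k = 1)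
    (σ : Matrix (Fin n) (Fin n) ℂ) : ∑ ω, (povm V ω * σ).trace = σ.trace := by
  rw [← trace_sum, ← Finset.sum_mul]
  simp only [povm, hV, one_mul]

theorem sum_probOut (hV : ∑ ω, ∑ k, (V ω k)ᴴ * V ω k = 1) {σ : Matrix (Fin n) (Fin n) ℂ}
    (hσ : IsDensityMatrix σ) : ∑ ω, probOut V σ ω = 1 := by
  simp only [probOut]
  rw [← Complex.re_sum, sum_trace_povm_mul hV, hσ.2, Complex.one_re]

theorem isDensityMatrix_sum_instAct (hV : ∑ ω, ∑ k, (V ω k)ᴴ * V ω k = 1)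
    {σ : Matrix (Fin n) (Fin n) ℂ} (hσ : IsDensityMatrix σ) :
    IsDensityMatrix (∑ ω, instAct V ω σ) := by
  refine ⟨posSemidef_sum _ fun ω _ => posSemidef_instAct hσ.1 ω, ?_⟩
  rw [trace_sum, ← hσ.2, ← sum_trace_povm_mul hV σ]
  simp only [trace_povm_mul]

end Instrument


theorem sum_ite_pos_div_smul {A M : Type*} [Fintype A] [AddCommMonoid M] [Module ℝ M] {r : A → ℝ}
    (hr : ∀ α, 0 ≤ r α) (s : ℝ) (x : A → M) :
    (∑ α, if 0 < r α then (r α / s) • x α else 0) = ∑ α, (r α / s) • x α := by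
  refine Finset.sum_congr rfl fun α _ => ?_
  split_ifs with h
  · rfl
  · rw [le_antisymm (not_lt.1 h) (hr α), zero_div, zero_smul]

theorem compound_chi_monotonicity {A Ω K : Type*} [Fintype A] [Fintype Ω] [Fintype K]
    [Nonempty A] [Nonempty Ω] [Nonempty K] {n m : ℕ} (hn : 1 ≤ n) (hm : 1 ≤ m)
    (p : A → ℝ) (hp0 : ∀ α, 0 ≤ p α) (hp1 : ∑ α, p α = 1)
    (ρ : A → Matrix (Fin n) (Fin n) ℂ) (hρ : ∀ α, IsDensityMatrix (ρ α))
    (V : Ω → K → Matrix (Fin m) (Fin n) ℂ)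
    (hV : ∑ ω, ∑ k, (V ω k)ᴴ * V ω k = 1)
    (η : Matrix (Fin n) (Fin n) ℂ) (hη : η = ∑ α, p α • ρ α)
    (Pf : Ω → ℝ) (hPf : ∀ ω, Pf ω = probOut V η ω)
    (ηfα : A → Matrix (Fin m) (Fin m) ℂ) (hηfα : ∀ α, ηfα α = ∑ ω, instAct V ω (ρ α))
    (εif : Ω → Matrix (Fin n × Fin m) (Fin n × Fin m) ℂ)
    (hεif : ∀ ω, 0 < Pf ω → εif ω =
      ∑ α, if 0 < p α * probOut V (ρ α) ω then
        ((p α * probOut V (ρ α) ω) / Pf ω) • (ρ α ⊗ₖ ηfα α) else 0)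
    (εi : Ω → Matrix (Fin n) (Fin n) ℂ)
    (hεi : ∀ ω, 0 < Pf ω → εi ω =
      ∑ α, if 0 < p α * probOut V (ρ α) ω then
        ((p α * probOut V (ρ α) ω) / Pf ω) • ρ α else 0)
    (εf : Ω → Matrix (Fin m) (Fin m) ℂ)
    (hεf : ∀ ω, 0 < Pf ω → εf ω =
      ∑ α, if 0 < p α * probOut V (ρ α) ω then
        ((p α * probOut V (ρ α) ω) / Pf ω) • ηfα α else 0) :
    holevoChi Pf εif ≥ holevoChi Pf εi ∧
    holevoChi Pf εif ≥ holevoChi Pf εf ∧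
    Ic p ρ V ≥ holevoChi Pf εi := by
  have hη' : ∀ α, IsDensityMatrix (ηfα α) := fun α => by
    rw [hηfα]
    exact isDensityMatrix_sum_instAct hV (hρ α)
  have hP : ∀ α ω, 0 ≤ probOut V (ρ α) ω := fun α ω => probOut_nonneg (hρ α).1 ω
  have hpP : ∀ α ω, 0 ≤ p α * probOut V (ρ α) ω := fun α ω => mul_nonneg (hp0 α) (hP α ω)
  have hPf_sum : ∀ ω, Pf ω = ∑ α, p α * probOut V (ρ α) ω := fun ω => by
    rw [hPf, hη, probOut_sum_smul]
  have hPf0 : ∀ ω, 0 ≤ Pf ω := fun ω => by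
    rw [hPf_sum]
    exact Finset.sum_nonneg fun α _ => hpP α ω
  have hr0 : ∀ α ω, 0 ≤ p α * probOut V (ρ α) ω / Pf ω := fun α ω =>
    div_nonneg (hpP α ω) (hPf0 ω)
  replace hεif : ∀ ω, 0 < Pf ω → εif ω =
      ∑ α, (p α * probOut V (ρ α) ω / Pf ω) • (ρ α ⊗ₖ ηfα α) := fun ω hω =>
    (hεif ω hω).trans (sum_ite_pos_div_smul (hpP · ω) _ _)
  replace hεi : ∀ ω, 0 < Pf ω → εi ω = ∑ α, (p α * probOut V (ρ α) ω / Pf ω) • ρ α :=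
    fun ω hω => (hεi ω hω).trans (sum_ite_pos_div_smul (hpP · ω) _ _)
  replace hεf : ∀ ω, 0 < Pf ω → εf ω = ∑ α, (p α * probOut V (ρ α) ω / Pf ω) • ηfα α :=
    fun ω hω => (hεf ω hω).trans (sum_ite_pos_div_smul (hpP · ω) _ _)
  have hεif_psd : ∀ ω, 0 < Pf ω → (εif ω).PosSemidef := fun ω hω => by
    rw [hεif ω hω]
    exact posSemidef_sum _ fun α _ => ((hρ α).1.kronecker (hη' α).1).smul (hr0 α ω)
  have hεi_psd : ∀ ω, 0 < Pf ω → (εi ω).PosSemidef := fun ω hω => by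
    rw [hεi ω hω]
    exact posSemidef_sum _ fun α _ => (hρ α).1.smul (hr0 α ω)
  have hεf_psd : ∀ ω, 0 < Pf ω → (εf ω).PosSemidef := fun ω hω => by
    rw [hεf ω hω]
    exact posSemidef_sum _ fun α _ => (hη' α).1.smul (hr0 α ω)
  refine ⟨?_, ?_, ?_⟩
  · refine holevoChi_le_of_trace_embedding hPf0 hεi_psd hεif_psd kroneckerOne fun ω hω X => ?_
    rw [hεif ω hω, hεi ω hω]
    simp only [Finset.mul_sum, trace_sum, mul_smul_comm, trace_smul, trace_kroneckerOne_mul,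
      (hη' _).2, mul_one]
  · refine holevoChi_le_of_trace_embedding hPf0 hεf_psd hεif_psd oneKronecker fun ω hω X => ?_
    rw [hεif ω hω, hεf ω hω]
    simp only [Finset.mul_sum, trace_sum, mul_smul_comm, trace_smul, trace_oneKronecker_mul,
      (hρ _).2, one_mul]
  · have hbar : ∑ ω, Pf ω • εi ω = ∑ α, p α • ρ α := by
      have h1 : ∀ ω, Pf ω • εi ω = ∑ α, (p α * probOut V (ρ α) ω) • ρ α := fun ω => by
        rcases (hPf0 ω).eq_or_lt with h | h
        · have hz := (Finset.sum_eq_zero_iff_of_nonneg fun α _ => hpP α ω).1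
            ((hPf_sum ω).symm.trans h.symm)
          rw [← h, zero_smul]
          exact (Finset.sum_eq_zero fun α hα => by rw [hz α hα, zero_smul]).symm
        · rw [hεi ω h, Finset.smul_sum]
          refine Finset.sum_congr rfl fun α _ => ?_
          rw [smul_smul, mul_div_cancel₀ _ h.ne']
      simp only [h1]
      rw [Finset.sum_comm]
      refine Finset.sum_congr rfl fun α _ => ?_
      rw [← Finset.sum_smul, ← Finset.mul_sum, sum_probOut hV (hρ α), mul_one]
    rw [ge_iff_le, Ic, Finset.sum_comm, holevoChi, hbar]
    refine Finset.sum_le_sum fun ω _ => ?_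
    rw [← hη, ← hPf]
    split_ifs with hω
    · have hle : ∀ α, Pf ω * (p α * probOut V (ρ α) ω / Pf ω) ≤ p α := fun α => by
        rw [mul_div_cancel₀ _ hω.ne']
        refine mul_le_of_le_one_right (hp0 α) ?_
        rw [← sum_probOut hV (hρ α)]
        exact Finset.single_le_sum (fun ω _ => hP α ω) (Finset.mem_univ ω)
      refine (mul_le_mul_of_nonneg_left (relEnt_sum_smul_le hρ (hr0 · ω) hp0 hω hle
        (hεi ω hω) hη) hω.le).trans_eq ?_
      rw [Finset.mul_sum]
      refine Finset.sum_congr rfl fun α _ => ?_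
      split_ifs with hα
      · have hpα : p α ≠ 0 := fun h => by simp [h] at hα
        rw [← mul_assoc, mul_div_cancel₀ _ hω.ne', ← Real.log_div (by positivity) hpα,
          div_div, mul_comm (Pf ω)]
      · rw [le_antisymm (not_lt.1 hα) (hpP α ω), zero_div, zero_mul, mul_zero]
    · refine Finset.sum_nonneg fun α _ => ?_
      rw [if_neg]
      intro hα
      refine hω (hα.trans_le ?_)
      rw [hPf_sum]
      exact Finset.single_le_sum (fun α _ => hpP α ω) (Finset.mem_univ α)

end
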